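/- arXiv:2312.08596 — 5 statements merged into one kernel-verified Lean document; each statement's English description precedes it below -/
import Mathlib

section
/- Let R be a commutative ring and let Z be a closed subset of Spec(R). If Z is a union of closed subsets of Spec(R) each of which has quasi-compact complement (i.e., Z is a Thomason subset), then the complement of Z is itself quasi-compact; equivalently, Z is the zero locus of a finitely generated ideal of R. Consequently, the Thomason closed subsets of Spec(R) are exactly the closed subsets with quasi-compact complement, and every Thomason subset of Spec(R) is a union of Thomason closed subsets. -/
/-- A subset of a topological space is *Thomason* if it is a union of closed subsets,
each of which has quasi-compact complement. -/
def IsThomason {X : Type*} [TopologicalSpace X] (S : Set X) : Prop :=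
  ∃ 𝒮 : Set (Set X), (∀ Z ∈ 𝒮, IsClosed Z ∧ IsCompact Zᶜ) ∧ S = ⋃₀ 𝒮

open Topology in
/-- In a prespectral space every open subset is open in the constructible topology. -/
theorem IsOpen.isOpen_constructibleTopology {X : Type*} [TopologicalSpace X] [PrespectralSpace X]
    {U : Set X} (hU : IsOpen U) : IsOpen[constructibleTopology X] U := by
  obtain ⟨𝒰, h𝒰, rfl⟩ := PrespectralSpace.isTopologicalBasis.open_eq_sUnion hU
  exact @isOpen_sUnion X (constructibleTopology X) _ fun V hV ↦
    (h𝒰 hV).2.isOpen_constructibleTopology_of_isOpen (h𝒰 hV).1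

/-- In a spectral space, a closed Thomason subset has quasi-compact complement. -/
theorem IsThomason.isCompact_compl_of_isClosed {X : Type*} [TopologicalSpace X] [SpectralSpace X]
    {Z : Set X} (hZ : IsThomason Z) (hZclosed : IsClosed Z) : IsCompact Zᶜ := by
  obtain ⟨𝒮, h𝒮, rfl⟩ := hZ
  let f : X → WithConstructibleTopology X := WithTopology.toTopology _
  let g : WithConstructibleTopology X → X := WithTopology.ofTopology
  have hclosed : IsClosed (g ⁻¹' ⋃₀ 𝒮) := by
    rw [WithConstructibleTopology.isClosed_iff, ← @isOpen_compl_iff X _ (constructibleTopology X)]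
    exact hZclosed.isOpen_compl.isOpen_constructibleTopology
  obtain ⟨t, ht, htfin, hcover⟩ := hclosed.isCompact.elim_finite_subcover_image (b := 𝒮)
    (c := fun S ↦ g ⁻¹' S)
    (fun S hS ↦ WithConstructibleTopology.isOpen_iff.mpr <|
      (h𝒮 S hS).2.isOpen_constructibleTopology_of_isClosed (h𝒮 S hS).1)
    (fun x ⟨S, hS, hx⟩ ↦ Set.mem_biUnion hS hx)
  have heq : ⋃₀ 𝒮 = ⋃₀ t := by
    refine (Set.sUnion_subset_sUnion ht).antisymm' fun x hx ↦ ?_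
    obtain ⟨S, hS, hxS⟩ := Set.mem_iUnion₂.mp (hcover (show f x ∈ g ⁻¹' ⋃₀ 𝒮 from hx))
    exact ⟨S, hS, hxS⟩
  rw [heq, Set.compl_sUnion]
  refine QuasiSeparatedSpace.isCompact_sInter (htfin.image _) ?_ ?_
  · rintro _ ⟨S, hS, rfl⟩
    exact .inl (h𝒮 S (ht hS)).1.isOpen_compl
  · rintro _ ⟨S, hS, rfl⟩
    exact (h𝒮 S (ht hS)).2

/-- If a closed subset `Z` of `Spec R` is Thomason, then its complement is quasi-compact,
equivalently `Z` is the zero locus of a finitely generated ideal.  Consequently every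
Thomason subset is a union of Thomason closed subsets. -/
theorem stmt0 {R : Type*} [CommRing R] (Z : Set (PrimeSpectrum R))
    (hZclosed : IsClosed Z) (hZThomason : IsThomason Z) :
    IsCompact Zᶜ ∧
    (∃ I : Ideal R, I.FG ∧ Z = PrimeSpectrum.zeroLocus (I : Set R)) ∧
    (∀ S : Set (PrimeSpectrum R), IsThomason S →
      ∃ 𝒮 : Set (Set (PrimeSpectrum R)),
        (∀ T ∈ 𝒮, IsClosed T ∧ IsCompact Tᶜ) ∧ S = ⋃₀ 𝒮) := by
  have hcompact := hZThomason.isCompact_compl_of_isClosed hZclosed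
  obtain ⟨I, hI, hIZ⟩ :=
    PrimeSpectrum.isCompact_isOpen_iff_ideal.mp ⟨hcompact, hZclosed.isOpen_compl⟩
  exact ⟨hcompact, ⟨I, hI, (compl_injective hIZ).symm⟩, fun _ hS ↦ hS⟩
end

section
/- Let R be a commutative ring and p ∈ Spec(R). The set {q ∈ Spec(R) : q ⊄ p, i.e. q is not contained in p}, which is the complement of gen(p), equals the union of the zero loci V(f) over all f ∉ p; in particular it is a Thomason subset of Spec(R). Moreover it is the largest Thomason subset of Spec(R) not containing p: every Thomason subset of Spec(R) that does not contain p is contained in the complement of gen(p). -/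
/-- The complement of `gen(p)` (the set of generalizations of a prime `p`) equals the union of
the zero loci `V(f)` over `f ∉ p`; in particular it is a Thomason subset, and it is the
largest Thomason subset of `Spec R` not containing `p`. -/
theorem stmt1 {R : Type*} [CommRing R] (p : PrimeSpectrum R) :
    ({q : PrimeSpectrum R | ¬ q.asIdeal ≤ p.asIdeal} =
      ⋃ f ∈ {f : R | f ∉ p.asIdeal}, PrimeSpectrum.zeroLocus {f}) ∧
    IsThomason {q : PrimeSpectrum R | ¬ q.asIdeal ≤ p.asIdeal} ∧
    (∀ S : Set (PrimeSpectrum R), IsThomason S → p ∉ S →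
      S ⊆ {q : PrimeSpectrum R | ¬ q.asIdeal ≤ p.asIdeal}) := by
  have union_eq : {q : PrimeSpectrum R | ¬ q.asIdeal ≤ p.asIdeal} =
      ⋃ f ∈ {f : R | f ∉ p.asIdeal}, PrimeSpectrum.zeroLocus {f} := by
    ext q
    simp only [Set.mem_ofPred_eq, SetLike.not_le_iff_exists, Set.mem_iUnion,
      PrimeSpectrum.mem_zeroLocus, Set.singleton_subset_iff, SetLike.mem_coe, exists_prop]
    exact exists_congr fun f => and_comm
  refine ⟨union_eq,
    ⟨(fun f : R => PrimeSpectrum.zeroLocus {f}) '' {f | f ∉ p.asIdeal}, ?_, ?_⟩, ?_⟩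
  · rintro _ ⟨f, -, rfl⟩
    refine ⟨PrimeSpectrum.isClosed_zeroLocus _, ?_⟩
    rw [← PrimeSpectrum.basicOpen_eq_zeroLocus_compl]
    exact PrimeSpectrum.isCompact_basicOpen f
  · rw [union_eq, Set.sUnion_image]
  · rintro _ ⟨𝒮, h𝒮, rfl⟩ hp q ⟨Z, hZ, hq⟩ hqp
    have hspec : q ⤳ p := (PrimeSpectrum.le_iff_specializes q p).mp hqp
    exact hp ⟨Z, hZ, hspec.mem_closed (h𝒮 Z hZ).1 hq⟩
end

section
/- Let R be a commutative ring and p ∈ Spec(R). Then p is weakly visible if and only if there exists a Thomason closed subset Z of Spec(R) such that {p} = Z ∩ gen(p); equivalently, if and only if there exists a finitely generated ideal I of R with {p} = V(I) ∩ gen(p). -/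
/-- A subset `W` is *weakly visible* if `W = U ∩ Vᶜ` for some Thomason subsets `U` and `V`. -/
def IsWeaklyVisible {X : Type*} [TopologicalSpace X] (W : Set X) : Prop :=
  ∃ U V : Set X, IsThomason U ∧ IsThomason V ∧ W = U ∩ Vᶜ

/-- The set of primes that are not generalizations of `p` is Thomason: it is the union of the
closed sets `V(f)` for `f ∉ p`. -/
theorem isThomason_compl_setOf_le {R : Type*} [CommRing R] (p : PrimeSpectrum R) :
    IsThomason {q : PrimeSpectrum R | q.asIdeal ≤ p.asIdeal}ᶜ := by
  refine ⟨(fun f : R => PrimeSpectrum.zeroLocus {f}) '' {f | f ∉ p.asIdeal}, ?_, ?_⟩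
  · rintro _ ⟨f, -, rfl⟩
    refine ⟨PrimeSpectrum.isClosed_zeroLocus _, ?_⟩
    rw [← PrimeSpectrum.basicOpen_eq_zeroLocus_compl]
    exact PrimeSpectrum.isCompact_basicOpen f
  · ext q
    simp [-PrimeSpectrum.asIdeal_le_asIdeal,
      SetLike.not_le_iff_exists, and_comm]

/-- A Thomason set is stable under specialization. -/
theorem IsThomason.mem_of_specializes {X : Type*} [TopologicalSpace X] {S : Set X}
    (hS : IsThomason S) {x y : X} (h : x ⤳ y) (hx : x ∈ S) : y ∈ S := by
  obtain ⟨𝒮, h𝒮, rfl⟩ := hS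
  obtain ⟨Z, hZ, hxZ⟩ := hx
  exact ⟨Z, hZ, h.mem_closed (h𝒮 Z hZ).1 hxZ⟩

/-- A closed subset with quasi-compact complement is Thomason. -/
theorem IsClosed.isThomason {X : Type*} [TopologicalSpace X] {Z : Set X}
    (hZ : IsClosed Z) (hZc : IsCompact Zᶜ) : IsThomason Z :=
  ⟨{Z}, by simpa using ⟨hZ, hZc⟩, by simp⟩

/-- A point is weakly visible iff it is the intersection of its generalizations with a
Thomason closed subset. -/
theorem isWeaklyVisible_singleton_iff {R : Type*} [CommRing R] (p : PrimeSpectrum R) :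
    IsWeaklyVisible ({p} : Set (PrimeSpectrum R)) ↔
      ∃ Z : Set (PrimeSpectrum R), IsClosed Z ∧ IsCompact Zᶜ ∧
        ({p} : Set (PrimeSpectrum R)) = Z ∩ {q | q.asIdeal ≤ p.asIdeal} := by
  constructor
  · rintro ⟨U, V, ⟨𝒮, h𝒮, rfl⟩, hV, h⟩
    obtain ⟨⟨Z, hZ, hpZ⟩, hpV⟩ := h.subset (Set.mem_singleton p)
    refine ⟨Z, (h𝒮 Z hZ).1, (h𝒮 Z hZ).2, Set.Subset.antisymm ?_ ?_⟩
    · exact Set.singleton_subset_iff.mpr ⟨hpZ, le_refl p.asIdeal⟩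
    · rintro q ⟨hqZ, hqp⟩
      rw [h]
      exact ⟨⟨Z, hZ, hqZ⟩, fun hqV => hpV
        (hV.mem_of_specializes ((PrimeSpectrum.le_iff_specializes q p).mp hqp) hqV)⟩
  · rintro ⟨Z, hZ, hZc, h⟩
    exact ⟨Z, _, hZ.isThomason hZc, isThomason_compl_setOf_le p, by rw [compl_compl, h]⟩

/-- A point `p` of `Spec R` is weakly visible iff `{p} = Z ∩ gen(p)` for some Thomason closed
subset `Z`, iff `{p} = V(I) ∩ gen(p)` for some finitely generated ideal `I`. -/
theorem stmt2 {R : Type*} [CommRing R] (p : PrimeSpectrum R) :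
    (IsWeaklyVisible ({p} : Set (PrimeSpectrum R)) ↔
      ∃ Z : Set (PrimeSpectrum R), IsClosed Z ∧ IsCompact Zᶜ ∧
        ({p} : Set (PrimeSpectrum R)) = Z ∩ {q | q.asIdeal ≤ p.asIdeal}) ∧
    (IsWeaklyVisible ({p} : Set (PrimeSpectrum R)) ↔
      ∃ I : Ideal R, I.FG ∧
        ({p} : Set (PrimeSpectrum R)) =
          PrimeSpectrum.zeroLocus (I : Set R) ∩ {q | q.asIdeal ≤ p.asIdeal}) := by
  refine ⟨isWeaklyVisible_singleton_iff p, (isWeaklyVisible_singleton_iff p).trans ?_⟩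
  constructor
  · rintro ⟨Z, hZ, hZc, h⟩
    obtain ⟨I, hI, hIZ⟩ :=
      PrimeSpectrum.isCompact_isOpen_iff_ideal.mp ⟨hZc, hZ.isOpen_compl⟩
    exact ⟨I, hI, by rw [compl_injective hIZ, h]⟩
  · rintro ⟨I, hI, h⟩
    exact ⟨PrimeSpectrum.zeroLocus I, PrimeSpectrum.isClosed_zeroLocus _,
      (PrimeSpectrum.isCompact_isOpen_iff_ideal.mpr ⟨I, hI, rfl⟩).1, h⟩
end

section
/- Let R be a commutative ring such that Spec(R) is a Noetherian topological space. Then every point of Spec(R) is weakly visible; that is, for each prime p there exist Thomason subsets U and V of Spec(R) with {p} = U ∩ Vᶜ (one may take U to be the closure of {p} and Vᶜ = gen(p)). In other words, every Noetherian spectrum is weakly Noetherian. -/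
/-- In a Noetherian space, every subset stable under specialization is Thomason. -/
theorem StableUnderSpecialization.isThomason {X : Type*} [TopologicalSpace X]
    [TopologicalSpace.NoetherianSpace X] {S : Set X} (hS : StableUnderSpecialization S) :
    IsThomason S := by
  refine ⟨(fun x => closure {x}) '' S, ?_, ?_⟩
  · rintro _ ⟨x, -, rfl⟩
    exact ⟨isClosed_closure, TopologicalSpace.NoetherianSpace.isCompact _⟩
  · ext y
    simp only [Set.sUnion_image, Set.mem_iUnion, exists_prop]
    exact ⟨fun hy => ⟨y, hy, subset_closure rfl⟩,
      fun ⟨x, hx, hy⟩ => hS (specializes_iff_mem_closure.mpr hy) hx⟩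

/-- If `Spec R` is a Noetherian space, then every point is weakly visible; one may take
`U = closure {p}` and `Vᶜ = gen(p)`.  In other words every Noetherian spectrum is weakly
Noetherian. -/
theorem stmt3 {R : Type*} [CommRing R]
    [TopologicalSpace.NoetherianSpace (PrimeSpectrum R)] (p : PrimeSpectrum R) :
    IsWeaklyVisible ({p} : Set (PrimeSpectrum R)) ∧
    IsThomason (closure ({p} : Set (PrimeSpectrum R))) ∧
    IsThomason {q : PrimeSpectrum R | ¬ q.asIdeal ≤ p.asIdeal} ∧
    ({p} : Set (PrimeSpectrum R)) =
      closure ({p} : Set (PrimeSpectrum R)) ∩ {q | q.asIdeal ≤ p.asIdeal} := by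
  have hU : IsThomason (closure ({p} : Set (PrimeSpectrum R))) :=
    isClosed_closure.stableUnderSpecialization.isThomason
  have hV : IsThomason {q : PrimeSpectrum R | ¬ q.asIdeal ≤ p.asIdeal} :=
    StableUnderSpecialization.isThomason fun x y hxy hx hy =>
      hx (((PrimeSpectrum.le_iff_specializes x y).mpr hxy).trans hy)
  have h : ({p} : Set (PrimeSpectrum R)) =
      closure ({p} : Set (PrimeSpectrum R)) ∩ {q | q.asIdeal ≤ p.asIdeal} := by
    ext q
    rw [Set.mem_singleton_iff, Set.mem_inter_iff, ← PrimeSpectrum.le_iff_mem_closure,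
      le_antisymm_iff, and_comm]
    rfl
  refine ⟨⟨_, _, hU, hV, ?_⟩, hU, hV, h⟩
  simpa only [Set.compl_ofPred, not_not] using h
end

section
/- Let R be a commutative ring. The localizing topology on Spec(R) is discrete if and only if every point of Spec(R) is weakly visible (i.e., Spec(R) is weakly Noetherian). Consequently, Spec(R) is weakly Noetherian if and only if every subset of Spec(R) is closed in the localizing topology. -/
/-- The *localizing topology* on `Spec R`: the topology generated by the weakly visible
subsets. -/
def localizingTopology (R : Type*) [CommRing R] : TopologicalSpace (PrimeSpectrum R) :=
  TopologicalSpace.generateFrom {W : Set (PrimeSpectrum R) | IsWeaklyVisible W}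

section

variable {X : Type*} [TopologicalSpace X] {S T : Set X}

theorem isThomason_empty : IsThomason (∅ : Set X) :=
  ⟨∅, by simp, by simp⟩

theorem isThomason_univ : IsThomason (Set.univ : Set X) :=
  ⟨{Set.univ}, by simp, by simp⟩

theorem IsThomason.union (hS : IsThomason S) (hT : IsThomason T) : IsThomason (S ∪ T) := by
  obtain ⟨𝒮, h𝒮, rfl⟩ := hS
  obtain ⟨𝒯, h𝒯, rfl⟩ := hT
  exact ⟨𝒮 ∪ 𝒯, fun Z hZ => hZ.elim (h𝒮 Z) (h𝒯 Z), Set.sUnion_union 𝒮 𝒯 |>.symm⟩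

theorem IsThomason.inter (hS : IsThomason S) (hT : IsThomason T) : IsThomason (S ∩ T) := by
  obtain ⟨𝒮, h𝒮, rfl⟩ := hS
  obtain ⟨𝒯, h𝒯, rfl⟩ := hT
  refine ⟨Set.image2 (· ∩ ·) 𝒮 𝒯, ?_, ?_⟩
  · rintro _ ⟨Z, hZ, Z', hZ', rfl⟩
    refine ⟨(h𝒮 Z hZ).1.inter (h𝒯 Z' hZ').1, ?_⟩
    rw [Set.compl_inter]
    exact (h𝒮 Z hZ).2.union (h𝒯 Z' hZ').2
  · ext x
    simp only [Set.mem_inter_iff, Set.mem_sUnion, Set.mem_image2]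
    constructor
    · rintro ⟨⟨Z, hZ, hx⟩, Z', hZ', hx'⟩
      exact ⟨Z ∩ Z', ⟨Z, hZ, Z', hZ', rfl⟩, hx, hx'⟩
    · rintro ⟨_, ⟨Z, hZ, Z', hZ', rfl⟩, hx, hx'⟩
      exact ⟨⟨Z, hZ, hx⟩, Z', hZ', hx'⟩

theorem isWeaklyVisible_univ : IsWeaklyVisible (Set.univ : Set X) :=
  ⟨Set.univ, ∅, isThomason_univ, isThomason_empty, by simp⟩

theorem IsWeaklyVisible.inter (hS : IsWeaklyVisible S) (hT : IsWeaklyVisible T) :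
    IsWeaklyVisible (S ∩ T) := by
  obtain ⟨U, V, hU, hV, rfl⟩ := hS
  obtain ⟨U', V', hU', hV', rfl⟩ := hT
  refine ⟨U ∩ U', V ∪ V', hU.inter hU', hV.union hV', ?_⟩
  rw [Set.compl_union, Set.inter_inter_inter_comm]

theorem finiteInter_isWeaklyVisible : FiniteInter {W : Set X | IsWeaklyVisible W} where
  univ_mem := isWeaklyVisible_univ
  inter_mem _ hS _ hT := hS.inter hT

end

theorem isOpen_singleton_localizingTopology_iff {R : Type*} [CommRing R] (p : PrimeSpectrum R) :
    @IsOpen _ (localizingTopology R) {p} ↔ IsWeaklyVisible ({p} : Set (PrimeSpectrum R)) := by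
  refine ⟨fun h => ?_, fun h => TopologicalSpace.isOpen_generateFrom_of_mem h⟩
  have basis := @TopologicalSpace.isTopologicalBasis_of_subbasis_of_finiteInter _
    (localizingTopology R) _ rfl finiteInter_isWeaklyVisible
  obtain ⟨W, hW, hpW, hWp⟩ :=
    @TopologicalSpace.IsTopologicalBasis.exists_subset_of_mem_open _ (localizingTopology R) _
      basis p {p} rfl h
  rwa [Set.Subset.antisymm hWp (Set.singleton_subset_iff.2 hpW)] at hW

theorem localizingTopology_eq_bot_iff {R : Type*} [CommRing R] :
    localizingTopology R = ⊥ ↔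
      ∀ p : PrimeSpectrum R, IsWeaklyVisible ({p} : Set (PrimeSpectrum R)) := by
  simp_rw [← isOpen_singleton_localizingTopology_iff]
  exact ⟨fun h p => h ▸ trivial, eq_bot_of_singletons_open⟩

/-- The localizing topology on `Spec R` is discrete iff every point of `Spec R` is weakly
visible (i.e. `Spec R` is weakly Noetherian); moreover this holds iff every subset of
`Spec R` is closed in the localizing topology. -/
theorem stmt8 {R : Type*} [CommRing R] :
    (localizingTopology R = ⊥ ↔
      ∀ p : PrimeSpectrum R, IsWeaklyVisible ({p} : Set (PrimeSpectrum R))) ∧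
    ((∀ p : PrimeSpectrum R, IsWeaklyVisible ({p} : Set (PrimeSpectrum R))) ↔
      ∀ S : Set (PrimeSpectrum R), @IsClosed (PrimeSpectrum R) (localizingTopology R) S) := by
  refine ⟨localizingTopology_eq_bot_iff, ?_⟩
  rw [← localizingTopology_eq_bot_iff,
    ← @discreteTopology_iff_forall_isClosed _ (localizingTopology R)]
  exact ⟨fun h => @DiscreteTopology.mk _ (localizingTopology R) h,
    fun h => @DiscreteTopology.eq_bot _ (localizingTopology R) h⟩
end
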